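/- Let ε ≥ 0, T > 0, and let u₁, u₂ : [0, T] × 𝕋 → ℂ be a classical solution of the regularized system with pressure law p(z) = −z + z̄³ (z̄ the complex conjugate of z), i.e. u₁, u₂, ∂ₜu₁, ∂ₜu₂, ∂ₓu₁, ∂ₓu₂ and ∂ₓ²u₂ exist and are continuous on [0, T] × 𝕋 and ∂ₜu₁ + ∂ₓu₂ = 0 and ∂ₜu₂ + ∂ₓ(−u₁ + conj(u₁)³) + iε∂ₓ²u₂ = 0 hold pointwise. Then the energy t ↦ ∫_𝕋 ( ¼ Re(u₁(t,x)⁴) − ½|u₁(t,x)|² + ½|u₂(t,x)|² ) dx is constant on [0, T]. -/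

import Mathlib

open MeasureTheory Filter

noncomputable section

open scoped ComplexConjugate

/-- If the time derivative `w` of a density `e` has vanishing spatial integral at every time,
then the spatial integral of `e` does not change in time. -/
theorem intervalIntegral_eq_of_integral_timeDeriv_eq_zero {T a b : ℝ} {e w : ℝ → ℝ → ℝ}
    (he : ∀ t ∈ Set.Icc (0:ℝ) T, Continuous (e t))
    (hw : ContinuousOn (fun q : ℝ × ℝ => w q.1 q.2) (Set.Icc 0 T ×ˢ Set.univ))
    (hd : ∀ t ∈ Set.Icc (0:ℝ) T, ∀ x : ℝ,
      HasDerivWithinAt (fun s => e s x) (w t x) (Set.Icc 0 T) t)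
    (h0 : ∀ t ∈ Set.Icc (0:ℝ) T, ∫ x in a..b, w t x = 0) :
    ∀ t ∈ Set.Icc (0:ℝ) T, ∫ x in a..b, e t x = ∫ x in a..b, e 0 x := by
  intro t ht
  have hsub : Set.Icc 0 t ⊆ Set.Icc 0 T := Set.Icc_subset_Icc_right ht.2
  have hzero : (0:ℝ) ∈ Set.Icc 0 T := ⟨le_rfl, ht.1.trans ht.2⟩
  have hftc : ∀ x : ℝ, ∫ s in (0:ℝ)..t, w s x = e t x - e 0 x := by
    intro x
    refine intervalIntegral.integral_eq_sub_of_hasDerivAt_of_le ht.1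
      (fun s hs => ((hd s (hsub hs) x).mono hsub).continuousWithinAt)
      (fun s hs => (hd s (hsub (Set.Ioo_subset_Icc_self hs)) x).hasDerivAt
        (Icc_mem_nhds hs.1 (hs.2.trans_le ht.2))) ?_
    refine ContinuousOn.intervalIntegrable_of_Icc ht.1 ?_
    exact hw.comp (f := fun s : ℝ => (s, x)) (by fun_prop)
      fun s hs => ⟨hsub hs, Set.mem_univ _⟩
  have hint : IntegrableOn (Function.uncurry w) (Set.uIoc 0 t ×ˢ Set.uIoc a b) := by
    have hcpt : IntegrableOn (Function.uncurry w) (Set.Icc 0 t ×ˢ Set.uIcc a b) :=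
      ContinuousOn.integrableOn_compact (isCompact_Icc.prod isCompact_uIcc)
        (hw.mono (Set.prod_mono hsub (Set.subset_univ _)))
    refine hcpt.mono_set (Set.prod_mono ?_ Set.uIoc_subset_uIcc)
    rw [Set.uIoc_of_le ht.1]
    exact Set.Ioc_subset_Icc_self
  rw [← sub_eq_zero, ← intervalIntegral.integral_sub
    ((he t ht).intervalIntegrable _ _) ((he 0 hzero).intervalIntegrable _ _)]
  simp_rw [← hftc]
  rw [← intervalIntegral_intervalIntegral_swap hint]
  refine (intervalIntegral.integral_congr (g := fun _ => (0:ℝ)) fun s hs => ?_).trans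
    intervalIntegral.integral_zero
  rw [Set.uIcc_of_le ht.1] at hs
  exact h0 s (hsub hs)

/-- A derivative of a periodic function is periodic. -/
theorem Function.Periodic.of_hasDerivAt {f f' : ℝ → ℂ} {c : ℝ} (hf : Function.Periodic f c)
    (hd : ∀ x, HasDerivAt f (f' x) x) : Function.Periodic f' c := by
  intro x
  have h := (hd (x + c)).comp_add_const x c
  rw [show (fun y => f (y + c)) = f from funext hf] at h
  exact h.unique (hd x)

theorem hasDerivWithinAt_energyDensity {u v : ℝ → ℂ} {u' v' : ℂ} {s : Set ℝ} {t : ℝ}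
    (hu : HasDerivWithinAt u u' s t) (hv : HasDerivWithinAt v v' s t) :
    HasDerivWithinAt
      (fun r => (1:ℝ) / 4 * ((u r) ^ 4).re - 1 / 2 * ‖u r‖ ^ 2 + 1 / 2 * ‖v r‖ ^ 2)
      ((conj (-u t + conj (u t) ^ 3) * u' + conj (v t) * v').re) s t := by
  have h4 := Complex.reCLM.hasFDerivAt.comp_hasDerivWithinAt t (hu.pow 4)
  have h := ((h4.const_mul ((1:ℝ) / 4)).sub (hu.norm_sq.const_mul ((1:ℝ) / 2))).add
    (hv.norm_sq.const_mul ((1:ℝ) / 2))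
  refine h.congr_deriv ?_
  simp [Complex.inner, pow_succ]
  ring

theorem hasDerivAt_energyFlux {p v vx : ℝ → ℂ} {p' v' : ℂ} {x : ℝ} (ε : ℝ)
    (hp : HasDerivAt p p' x) (hv : HasDerivAt v (vx x) x) (hvx : HasDerivAt vx v' x) :
    HasDerivAt (fun y => -(conj (p y) * v y + Complex.I * ε * (conj (v y) * vx y)).re)
      ((conj (p x) * -vx x + conj (v x) * (-p' - Complex.I * ε * v')).re) x := by
  have hG := ((hp.star.mul hv).add ((hv.star.mul hvx).const_mul (Complex.I * (ε:ℂ))))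
  have h := (Complex.reCLM.hasFDerivAt.comp_hasDerivAt x hG).neg
  refine h.congr_deriv ?_
  simp
  ring

/-- Energy conservation for classical solutions of the regularized system with
pressure law `p(z) = −z + conj(z)³`. -/
theorem energy_conservation_p2 (ε T : ℝ) (hε : 0 ≤ ε) (hT : 0 < T)
    (u₁ u₂ d₁t d₂t d₁x d₂x d₂xx dpx : ℝ → ℝ → ℂ)
    (hper₁ : ∀ t ∈ Set.Icc (0:ℝ) T, Function.Periodic (u₁ t) (2 * Real.pi))
    (hper₂ : ∀ t ∈ Set.Icc (0:ℝ) T, Function.Periodic (u₂ t) (2 * Real.pi))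
    (hu₁ : ContinuousOn (fun q : ℝ × ℝ => u₁ q.1 q.2) (Set.Icc 0 T ×ˢ Set.univ))
    (hu₂ : ContinuousOn (fun q : ℝ × ℝ => u₂ q.1 q.2) (Set.Icc 0 T ×ˢ Set.univ))
    (hc₁t : ContinuousOn (fun q : ℝ × ℝ => d₁t q.1 q.2) (Set.Icc 0 T ×ˢ Set.univ))
    (hc₂t : ContinuousOn (fun q : ℝ × ℝ => d₂t q.1 q.2) (Set.Icc 0 T ×ˢ Set.univ))
    (hc₁x : ContinuousOn (fun q : ℝ × ℝ => d₁x q.1 q.2) (Set.Icc 0 T ×ˢ Set.univ))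
    (hc₂x : ContinuousOn (fun q : ℝ × ℝ => d₂x q.1 q.2) (Set.Icc 0 T ×ˢ Set.univ))
    (hc₂xx : ContinuousOn (fun q : ℝ × ℝ => d₂xx q.1 q.2) (Set.Icc 0 T ×ˢ Set.univ))
    (hd₁t : ∀ t ∈ Set.Icc (0:ℝ) T, ∀ x : ℝ,
      HasDerivWithinAt (fun s => u₁ s x) (d₁t t x) (Set.Icc 0 T) t)
    (hd₂t : ∀ t ∈ Set.Icc (0:ℝ) T, ∀ x : ℝ,
      HasDerivWithinAt (fun s => u₂ s x) (d₂t t x) (Set.Icc 0 T) t)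
    (hd₁x : ∀ t ∈ Set.Icc (0:ℝ) T, ∀ x : ℝ, HasDerivAt (fun y => u₁ t y) (d₁x t x) x)
    (hd₂x : ∀ t ∈ Set.Icc (0:ℝ) T, ∀ x : ℝ, HasDerivAt (fun y => u₂ t y) (d₂x t x) x)
    (hd₂xx : ∀ t ∈ Set.Icc (0:ℝ) T, ∀ x : ℝ, HasDerivAt (fun y => d₂x t y) (d₂xx t x) x)
    (hdpx : ∀ t ∈ Set.Icc (0:ℝ) T, ∀ x : ℝ,
      HasDerivAt (fun y => -u₁ t y + (starRingEnd ℂ (u₁ t y)) ^ 3) (dpx t x) x)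
    (heq₁ : ∀ t ∈ Set.Icc (0:ℝ) T, ∀ x : ℝ, d₁t t x + d₂x t x = 0)
    (heq₂ : ∀ t ∈ Set.Icc (0:ℝ) T, ∀ x : ℝ,
      d₂t t x + dpx t x + Complex.I * (ε:ℂ) * d₂xx t x = 0) :
    ∀ t ∈ Set.Icc (0:ℝ) T,
      (∫ x in (0:ℝ)..(2 * Real.pi),
        ((1:ℝ) / 4 * ((u₁ t x) ^ 4).re - 1 / 2 * ‖u₁ t x‖ ^ 2 + 1 / 2 * ‖u₂ t x‖ ^ 2))
      = ∫ x in (0:ℝ)..(2 * Real.pi),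
        ((1:ℝ) / 4 * ((u₁ 0 x) ^ 4).re - 1 / 2 * ‖u₁ 0 x‖ ^ 2 + 1 / 2 * ‖u₂ 0 x‖ ^ 2) := by
  have hslice : ∀ {f : ℝ → ℝ → ℂ},
      ContinuousOn (fun q : ℝ × ℝ => f q.1 q.2) (Set.Icc 0 T ×ˢ Set.univ) →
      ∀ t ∈ Set.Icc (0:ℝ) T, Continuous (f t) := fun hf t ht =>
    hf.comp_continuous (f := fun x : ℝ => (t, x)) (by fun_prop) fun _ => ⟨ht, Set.mem_univ _⟩
  have hw : ContinuousOn (fun q : ℝ × ℝ =>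
      (conj (-u₁ q.1 q.2 + conj (u₁ q.1 q.2) ^ 3) * d₁t q.1 q.2
        + conj (u₂ q.1 q.2) * d₂t q.1 q.2).re) (Set.Icc 0 T ×ˢ Set.univ) :=
    Complex.continuous_re.comp_continuousOn
      (((Complex.continuous_conj.comp_continuousOn
        (hu₁.neg.add ((Complex.continuous_conj.comp_continuousOn hu₁).pow 3))).mul hc₁t).add
        ((Complex.continuous_conj.comp_continuousOn hu₂).mul hc₂t))
  refine intervalIntegral_eq_of_integral_timeDeriv_eq_zero
    (w := fun t x => (conj (-u₁ t x + conj (u₁ t x) ^ 3) * d₁t t x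
      + conj (u₂ t x) * d₂t t x).re) (fun t ht => ?_) hw
    (fun t ht x => hasDerivWithinAt_energyDensity (hd₁t t ht x) (hd₂t t ht x)) (fun t ht => ?_)
  · have h₁ := hslice hu₁ t ht
    have h₂ := hslice hu₂ t ht
    fun_prop
  · have hwt := hw.comp_continuous (f := fun x : ℝ => (t, x)) (by fun_prop)
      fun _ => ⟨ht, Set.mem_univ _⟩
    have hflux : ∀ x, HasDerivAt _ _ x := fun x =>
      hasDerivAt_energyFlux ε (hdpx t ht x) (hd₂x t ht x) (hd₂xx t ht x)
    refine (intervalIntegral.integral_eq_sub_of_hasDerivAt (fun x _ =>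
      (hflux x).congr_deriv ?_) (hwt.intervalIntegrable _ _)).trans ?_
    · dsimp only [Function.comp_apply]
      rw [eq_neg_of_add_eq_zero_left (heq₁ t ht x),
        show d₂t t x = -dpx t x - Complex.I * ε * d₂xx t x by linear_combination heq₂ t ht x]
    · have e₁ := (hper₁ t ht).eq
      have e₂ := (hper₂ t ht).eq
      have e₃ := ((hper₂ t ht).of_hasDerivAt (hd₂x t ht)).eq
      simp only [e₁, e₂, e₃, sub_self]
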